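/- Let n ≥ 3 and let B be an n×n real symmetric matrix. Suppose every diagonal entry of B is nonzero, every principal minor of B of order 2 is zero, and every principal minor of order 3 is nonzero. Then exactly one of the following holds: (1) every diagonal entry of B is positive and, for every j with 3 ≤ j ≤ n, every principal minor of order j is negative; or (2) every diagonal entry of B is negative and, for every j with 3 ≤ j ≤ n, every principal minor of order j is positive if j is odd and negative if j is even. -/

import Mathlib

/-- The principal minor of the real matrix `B` indexed by the subset `α`. -/
noncomputable def pminorR {n : ℕ} (B : Matrix (Fin n) (Fin n) ℝ) (α : Finset (Fin n)) : ℝ :=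
  Matrix.det (fun i j : α => B i j)

theorem pminorR_map_univ {n k : ℕ} (B : Matrix (Fin n) (Fin n) ℝ) (f : Fin k ↪ Fin n) :
    pminorR B (Finset.univ.map f) = (B.submatrix f f).det := by
  let g : Fin k → (Finset.univ.map f : Finset (Fin n)) := fun i => ⟨f i, by simp⟩
  have hg : Function.Bijective g := by
    refine ⟨fun i j h => f.injective (congrArg Subtype.val h), ?_⟩
    rintro ⟨x, hx⟩
    obtain ⟨i, -, rfl⟩ := Finset.mem_map.mp hx
    exact ⟨i, rfl⟩
  exact (Matrix.det_submatrix_equiv_self (Equiv.ofBijective g hg) _).symm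

theorem entry_sq_of_pminorR_two_eq_zero {n : ℕ} {B : Matrix (Fin n) (Fin n) ℝ} (hB : B.IsSymm)
    (h2 : ∀ α : Finset (Fin n), α.card = 2 → pminorR B α = 0) (i j : Fin n) :
    B i j ^ 2 = B i i * B j j := by
  rcases eq_or_ne i j with rfl | hij
  · ring
  have hf : Function.Injective ![i, j] := by
    intro a b
    fin_cases a <;> fin_cases b <;> simp [hij, hij.symm]
  have h := h2 (Finset.univ.map ⟨_, hf⟩) (by simp)
  rw [pminorR_map_univ, Matrix.det_fin_two] at h
  simp only [Matrix.submatrix_apply, Function.Embedding.coeFn_mk, Matrix.cons_val_zero,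
    Matrix.cons_val_one] at h
  rw [hB.apply i j] at h
  linear_combination -h

theorem triple_product_eq_neg {n : ℕ} {B : Matrix (Fin n) (Fin n) ℝ} (hB : B.IsSymm)
    (h2 : ∀ α : Finset (Fin n), α.card = 2 → pminorR B α = 0)
    (h3 : ∀ α : Finset (Fin n), α.card = 3 → pminorR B α ≠ 0) {i j k : Fin n}
    (hij : i ≠ j) (hik : i ≠ k) (hjk : j ≠ k) :
    B i j * B i k * B j k = -(B i i * B j j * B k k) := by
  have hf : Function.Injective ![i, j, k] := by
    intro a b
    fin_cases a <;> fin_cases b <;>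
      simp [hij, hij.symm, hik, hik.symm, hjk, hjk.symm]
  have h := h3 (Finset.univ.map ⟨_, hf⟩) (by simp)
  rw [pminorR_map_univ, Matrix.det_fin_three] at h
  simp only [Matrix.submatrix_apply, Function.Embedding.coeFn_mk, Matrix.cons_val_zero,
    Matrix.cons_val_one, Matrix.cons_val] at h
  rw [hB.apply i j, hB.apply i k, hB.apply j k] at h
  have sij := entry_sq_of_pminorR_two_eq_zero hB h2 i j
  have sik := entry_sq_of_pminorR_two_eq_zero hB h2 i k
  have sjk := entry_sq_of_pminorR_two_eq_zero hB h2 j k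
  have hsq : (B i j * B i k * B j k) ^ 2 = (B i i * B j j * B k k) ^ 2 := by
    rw [mul_pow, mul_pow, sij, sik, sjk]
    ring
  rcases sq_eq_sq_iff_eq_or_eq_neg.mp hsq with h' | h'
  · exact absurd (by linear_combination 2 * h' - B k k * sij - B j j * sik - B i i * sjk) h
  · exact h'

theorem det_smul_signed_rank_one {ι : Type*} [Fintype ι] [DecidableEq ι] (c : ℝ) (v : ι → ℝ) :
    (Matrix.of fun i j => if i = j then c * v i * v i else -(c * v i * v j)).det =
      (2 * c) ^ Fintype.card ι * (∏ i, v i) ^ 2 * (1 - Fintype.card ι / 2) := by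
  have hfac : (Matrix.of fun i j => if i = j then c * v i * v i else -(c * v i * v j)) =
      Matrix.diagonal (fun i => 2 * c * v i) *
        (1 + Matrix.vecMulVec (fun _ => (-1 / 2 : ℝ)) (fun _ => 1)) * Matrix.diagonal v := by
    ext i j
    rw [Matrix.mul_diagonal, Matrix.diagonal_mul]
    by_cases h : i = j
    · subst h
      simp only [Matrix.of_apply, if_true, Matrix.add_apply, Matrix.one_apply_eq,
        Matrix.vecMulVec_apply]
      ring
    · simp [h, Matrix.vecMulVec_apply]
      ring
  rw [hfac, Matrix.det_mul, Matrix.det_mul, Matrix.det_diagonal, Matrix.det_diagonal,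
    Matrix.vecMulVec_eq Unit, Matrix.det_one_add_replicateCol_mul_replicateRow,
    Finset.prod_mul_distrib]
  simp [dotProduct]
  ring

/-- Under the hypotheses on minors of orders 1, 2 and 3, every principal minor is determined up to
a positive factor by its order and the sign of any one diagonal entry. -/
theorem exists_pos_pminorR_eq {n : ℕ} {B : Matrix (Fin n) (Fin n) ℝ} (hB : B.IsSymm)
    (h1 : ∀ i : Fin n, B i i ≠ 0)
    (h2 : ∀ α : Finset (Fin n), α.card = 2 → pminorR B α = 0)
    (h3 : ∀ α : Finset (Fin n), α.card = 3 → pminorR B α ≠ 0) (o : Fin n)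
    (α : Finset (Fin n)) :
    ∃ p : ℝ, 0 < p ∧ pminorR B α = (B o o)⁻¹ ^ α.card * p * (1 - α.card / 2) := by
  have hs := entry_sq_of_pminorR_two_eq_zero hB h2
  have hne : ∀ i j, B i j ≠ 0 := fun i j h => by
    have := hs i j
    rw [h] at this
    exact mul_ne_zero (h1 i) (h1 j) (by linear_combination -this)
  let v : Fin n → ℝ := fun i => if i = o then -B o o else B o i
  have hv : ∀ i, v i ≠ 0 := fun i => by
    by_cases h : i = o <;> simp [v, h, hne]
  have hentry : ∀ i j, B i j =
      if i = j then (B o o)⁻¹ * v i * v i else -((B o o)⁻¹ * v i * v j) := by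
    intro i j
    have ho := h1 o
    by_cases hij : i = j
    · subst hij
      by_cases hi : i = o
      · subst hi
        simp [v, ho]
      · simp only [v, hi, if_true, if_false]
        field_simp
        linear_combination -hs o i
    · by_cases hi : i = o
      · subst hi
        simp [v, ho, hij, Ne.symm hij]
      · by_cases hj : j = o
        · subst hj
          simp only [v, hij, if_true, if_false]
          rw [hB.apply j i]
          field_simp
        · have ht := triple_product_eq_neg hB h2 h3 (Ne.symm hi) (Ne.symm hj) hij
          simp only [v, hi, hj, hij, if_false]
          have : B o i * B o j ≠ 0 := mul_ne_zero (hne o i) (hne o j)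
          refine mul_left_cancel₀ this ?_
          calc B o i * B o j * B i j = -((B o o)⁻¹ * (B o o * B i i) * (B o o * B j j)) := by
                field_simp
                linear_combination ht
            _ = B o i * B o j * -((B o o)⁻¹ * B o i * B o j) := by
                rw [← hs, ← hs]
                ring
  have hprod : (∏ i : α, v i) ≠ 0 := Finset.prod_ne_zero_iff.mpr fun i _ => hv i
  refine ⟨2 ^ α.card * (∏ i : α, v i) ^ 2, by positivity, ?_⟩
  have hdet := det_smul_signed_rank_one (B o o)⁻¹ (fun i : α => v i)
  rw [Fintype.card_coe, mul_pow] at hdet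
  have hmat : (fun i j : α => B i j) = Matrix.of fun i j : α =>
      if i = j then (B o o)⁻¹ * v i * v i else -((B o o)⁻¹ * v i * v j) := by
    ext i j
    rw [hentry i j]
    simp only [Matrix.of_apply, Subtype.coe_inj]
  rw [pminorR, hmat, hdet]
  ring

/-- a real symmetric matrix whose sepr-sequence begins with ANA (with the N in
position 2) has sepr-sequence A⁺NA⁻A⁻⋯A⁻ or A⁻NA⁺A⁻A⁺⋯ (alternating), and exactly one of
these two sign patterns occurs. -/
theorem ANA_at_start {n : ℕ} (hn : 3 ≤ n) (B : Matrix (Fin n) (Fin n) ℝ) (hB : B.IsSymm)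
    (h1 : ∀ i : Fin n, B i i ≠ 0)
    (h2 : ∀ α : Finset (Fin n), α.card = 2 → pminorR B α = 0)
    (h3 : ∀ α : Finset (Fin n), α.card = 3 → pminorR B α ≠ 0) :
    Xor'
      ((∀ i : Fin n, 0 < B i i) ∧
        (∀ j : ℕ, 3 ≤ j → j ≤ n →
          ∀ α : Finset (Fin n), α.card = j → pminorR B α < 0))
      ((∀ i : Fin n, B i i < 0) ∧
        (∀ j : ℕ, 3 ≤ j → j ≤ n →
          ∀ α : Finset (Fin n), α.card = j →
            (Odd j → 0 < pminorR B α) ∧ (Even j → pminorR B α < 0))) := by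
  have hs := entry_sq_of_pminorR_two_eq_zero hB h2
  let o : Fin n := ⟨0, by omega⟩
  have hsame : ∀ i, 0 < B o o * B i i := fun i => by
    have := mul_ne_zero (h1 o) (h1 i)
    rw [← hs o i] at this ⊢
    positivity
  have hminor := exists_pos_pminorR_eq hB h1 h2 h3 o
  have hcard : ∀ α : Finset (Fin n), 3 ≤ α.card → (1 - (α.card : ℝ) / 2) < 0 := fun α hα => by
    have : (3 : ℝ) ≤ α.card := by exact_mod_cast hα
    linarith
  rcases (h1 o).lt_or_gt with ho | ho
  · refine Or.inr ⟨⟨fun i => (neg_iff_neg_of_mul_pos (hsame i)).mp ho, ?_⟩,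
      fun h => lt_asymm ho (h.1 o)⟩
    rintro j hj - α rfl
    obtain ⟨p, hp, h⟩ := hminor α
    have hi := inv_lt_zero.mpr ho
    rw [h]
    exact ⟨fun hodd => mul_pos_of_neg_of_neg
        (mul_neg_of_neg_of_pos (hodd.pow_neg hi) hp) (hcard α hj),
      fun heven => mul_neg_of_pos_of_neg (mul_pos (heven.pow_pos hi.ne) hp) (hcard α hj)⟩
  · refine Or.inl ⟨⟨fun i => (pos_iff_pos_of_mul_pos (hsame i)).mp ho, ?_⟩,
      fun h => lt_asymm ho (h.1 o)⟩
    rintro j hj - α rfl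
    obtain ⟨p, hp, h⟩ := hminor α
    rw [h]
    exact mul_neg_of_pos_of_neg (by positivity) (hcard α hj)
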